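/- arXiv:1510.03573 — 2 statements merged into one kernel-verified Lean document; each statement's English description precedes it below -/
import Mathlib

section
/- Let (A, m, k) be a complete Noetherian local ring of equal characteristic p > 0, let {α_i}_{i∈Λ} ⊆ A be elements whose images in k form a p-basis of k over 𝔽_p. Then there exists a unique coefficient field φ : k → A with φ(ᾱ_i) = α_i for all i ∈ Λ. -/
open IsLocalRing

open MvPolynomial Algebra in
lemma h1_iff (R S : Type*) [CommRing R] [CommRing S] [Algebra R S] :
    Subsingleton (H1Cotangent R S) ↔ ∀ x : MvPolynomial S R,
      aeval (R := R) (id : S → S) x = 0 → (∀ i, aeval (R := R) (id : S → S) (pderiv i x) = 0) →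
      x ∈ (RingHom.ker (aeval (R := R) (id : S → S)).toRingHom) ^ 2 := by
  have hker : (Generators.self R S).toExtension.ker =
      RingHom.ker (aeval (R := R) (id : S → S)).toRingHom := rfl
  rw [Extension.subsingleton_h1Cotangent, injective_iff_map_eq_zero]
  have key : ∀ x : (Generators.self R S).toExtension.ker,
      (Generators.self R S).toExtension.cotangentComplex (.mk x) = 0 ↔
        ∀ i, aeval (R := R) (id : S → S) (pderiv i (x.1 : MvPolynomial S R)) = 0 := by
    intro x
    rw [← (Generators.self R S).cotangentSpaceBasis.repr.map_eq_zero_iff, Finsupp.ext_iff]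
    refine forall_congr' fun i => ?_
    rw [Extension.cotangentComplex_mk]
    erw [Generators.cotangentSpaceBasis_repr_one_tmul]
    rfl
  constructor
  · intro H x hx hd
    have := H (.mk ⟨x, hx⟩) ((key ⟨x, hx⟩).mpr hd)
    rw [Extension.Cotangent.mk_eq_zero_iff] at this
    exact this
  · intro H x hx
    obtain ⟨x, rfl⟩ := Extension.Cotangent.mk_surjective x
    rw [Extension.Cotangent.mk_eq_zero_iff]
    exact H x.1 x.2 ((key x).mp hx)

open MvPolynomial Algebra in
lemma h1_perfect (K L : Type*) [Field K] [Field L] [Algebra K L] [PerfectField K] :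
    Subsingleton (H1Cotangent K L) := by
  classical
  rw [h1_iff]
  intro x hx hd
  obtain ⟨F, hF, hsub⟩ : ∃ F : IntermediateField K L, EssFiniteType K F ∧
      (x.vars : Set L) ⊆ F :=
    ⟨IntermediateField.adjoin K (x.vars : Set L),
      IntermediateField.essFiniteType_iff.mpr (IntermediateField.fg_adjoin_finset _),
      IntermediateField.subset_adjoin K _⟩
  obtain ⟨y, rfl⟩ : ∃ y : MvPolynomial F K, rename (algebraMap F L) y = x := by
    obtain ⟨y, hy⟩ := exists_rename_eq_of_vars_subset_range x (algebraMap F L)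
      (algebraMap F L).injective (fun a ha =>
        ⟨⟨a, hsub ha⟩, rfl⟩)
    exact ⟨y, hy⟩
  have h1 : Subsingleton (H1Cotangent K F) := inferInstance
  rw [h1_iff] at h1
  have comm : ∀ z : MvPolynomial F K, aeval (R := K) (id : L → L) (rename (algebraMap F L) z) =
      algebraMap F L (aeval (R := K) (id : F → F) z) := by
    intro z
    rw [aeval_rename, ← aeval_algebraMap_apply]; rfl
  have := h1 y (by
    apply (algebraMap F L).injective
    rw [← comm, hx, map_zero]) (fun i => by
    apply (algebraMap F L).injective
    rw [← comm, ← pderiv_rename (algebraMap F L).injective, hd, map_zero])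
  have hle : (RingHom.ker (aeval (R := K) (id : F → F)).toRingHom) ≤
      (RingHom.ker (aeval (R := K) (id : L → L)).toRingHom).comap
        (rename (R := K) (algebraMap F L)).toRingHom := by
    intro z hz
    have hz' : aeval (R := K) (id : F → F) z = 0 := hz
    change aeval (R := K) (id : L → L) (rename (algebraMap F L) z) = 0
    rw [comm, hz', map_zero]
  exact Ideal.le_comap_pow _ 2 (Ideal.pow_right_mono hle 2 this)

open TensorProduct in
lemma etale_of_basis (R k Λ : Type*) [CommRing R] [Field k] [Algebra R k]
    [Algebra (MvPolynomial Λ R) k] [IsScalarTower R (MvPolynomial Λ R) k]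
    (hH : Subsingleton (Algebra.H1Cotangent R k))
    (b : Λ → k) (hb : ∀ i, algebraMap (MvPolynomial Λ R) k (.X i) = b i)
    (hli : LinearIndependent k (fun i => KaehlerDifferential.D R k (b i)))
    (hspan : Submodule.span k (Set.range fun i => KaehlerDifferential.D R k (b i)) = ⊤) :
    Algebra.FormallyEtale (MvPolynomial Λ R) k := by
  let P := MvPolynomial Λ R
  let B := (KaehlerDifferential.mvPolynomialBasis R Λ).baseChange k
  let C := Module.Basis.mk hli hspan.ge
  have hBC : KaehlerDifferential.mapBaseChange R P k =
      (B.equiv C (Equiv.refl _)).toLinearMap := by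
    apply B.ext
    intro i
    rw [LinearEquiv.coe_coe, Module.Basis.equiv_apply]
    simp [B, C, P, hb]
  have hbij : Function.Bijective (KaehlerDifferential.mapBaseChange R P k) := by
    rw [hBC]; exact (B.equiv C (Equiv.refl _)).bijective
  constructor
  · refine subsingleton_of_forall_eq 0 fun x => ?_
    obtain ⟨y, rfl⟩ := KaehlerDifferential.map_surjective R P k x
    obtain ⟨z, rfl⟩ := hbij.2 y
    exact (KaehlerDifferential.exact_mapBaseChange_map R P k).apply_apply_eq_zero z
  · refine subsingleton_of_forall_eq 0 fun x => ?_
    have h0 : Algebra.H1Cotangent.δ R P k x = 0 := by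
      apply hbij.1
      rw [(Algebra.H1Cotangent.exact_δ_mapBaseChange R P k).apply_apply_eq_zero, map_zero]
    obtain ⟨y, rfl⟩ := (Algebra.H1Cotangent.exact_map_δ R P k x).mp h0
    rw [Subsingleton.elim y 0, map_zero]

theorem cohen_coefficient_field
    (p : ℕ) (hp : p.Prime) [Fact p.Prime]
    (A : Type*) [CommRing A] [IsLocalRing A] [IsNoetherianRing A]
    [IsAdicComplete (maximalIdeal A) A] [CharP A p]
    [Algebra (ZMod p) (ResidueField A)]
    (Λ : Type*) (α : Λ → A)
    (hli : LinearIndependent (ResidueField A)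
      (fun i : Λ => (KaehlerDifferential.D (ZMod p) (ResidueField A)) (residue A (α i))))
    (hspan : Submodule.span (ResidueField A)
      (Set.range fun i : Λ =>
        (KaehlerDifferential.D (ZMod p) (ResidueField A)) (residue A (α i))) = ⊤) :
    ∃! φ : ResidueField A →+* A,
      (residue A).comp φ = RingHom.id (ResidueField A) ∧
      ∀ i : Λ, φ (residue A (α i)) = α i := by
  let P := MvPolynomial Λ (ZMod p)
  let c : P →+* A := MvPolynomial.eval₂Hom (ZMod.castHom dvd_rfl A) α
  have hcX : ∀ i, c (.X i) = α i := fun i => MvPolynomial.eval₂Hom_X' _ _ _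
  let : Algebra P A := c.toAlgebra
  have hmap : ∀ x : P, algebraMap P (ResidueField A) x = residue A (c x) := fun x => rfl
  have : IsScalarTower (ZMod p) P (ResidueField A) :=
    .of_algebraMap_eq' (Subsingleton.elim _ _)
  have : Algebra.FormallyEtale P (ResidueField A) :=
    etale_of_basis (ZMod p) (ResidueField A) Λ (h1_perfect _ _) (fun i => residue A (α i))
      (fun i => by rw [← hcX i]; rfl) hli hspan
  have comm : ∀ φ : ResidueField A →+* A, (∀ i : Λ, φ (residue A (α i)) = α i) →
      ∀ x : P, φ (algebraMap P (ResidueField A) x) = algebraMap P A x := by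
    intro φ h x
    change (φ.comp ((residue A).comp c)) x = c x
    congr 1
    refine MvPolynomial.ringHom_ext' (Subsingleton.elim _ _) fun i => ?_
    simp only [RingHom.comp_apply, hcX, h]
  obtain ⟨g, hg⟩ := Algebra.FormallySmooth.exists_mkₐ_comp_eq_of_isAdicComplete
    (R := P) (A := ResidueField A) (S := A) (I := maximalIdeal A)
    (AlgHom.id P (ResidueField A))
  refine ⟨g.toRingHom, ⟨?_, fun i => ?_⟩, ?_⟩
  · ext x
    exact congr($hg x)
  · rw [← hcX i]
    exact g.commutes (.X i)
  · rintro φ ⟨h1, h2⟩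
    let g' : ResidueField A →ₐ[P] A := { φ with commutes' := comm φ h2 }
    have : g' = g := by
      refine Algebra.FormallyUnramified.ext_of_iInf (I := maximalIdeal A) ?_ fun x => ?_
      · exact Ideal.iInf_pow_eq_bot_of_isLocalRing _ (Ideal.IsPrime.ne_top inferInstance)
      · exact congr($h1 x).trans congr($hg x).symm
    rw [← this]
end

section
/- Let B = 𝔽_p(t)[X,Y]/(tX^p + Y^p) with t transcendental over 𝔽_p. For any z ∈ B such that 𝔽_p(t)[z] ↪ B is module-finite, the field extension Frac(𝔽_p(t)[z]) → Frac(B) is not separable. -/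
set_option synthInstance.maxHeartbeats 1000000
set_option maxHeartbeats 1000000

/-- The polynomial `t X^p + Y^p` over `𝔽_p(t)`. -/
noncomputable abbrev cgExamplePoly (p : ℕ) [Fact p.Prime] :
    MvPolynomial (Fin 2) (RatFunc (ZMod p)) :=
  MvPolynomial.C RatFunc.X * MvPolynomial.X 0 ^ p + MvPolynomial.X 1 ^ p

/-- `B = 𝔽_p(t)[X,Y]/(t X^p + Y^p)`. -/
noncomputable abbrev cgExampleB (p : ℕ) [Fact p.Prime] :=
  MvPolynomial (Fin 2) (RatFunc (ZMod p)) ⧸ Ideal.span {cgExamplePoly p}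

open Polynomial in
lemma cg_sep_unique {A L S : Type*} [CommRing A] [CommRing L] [CommRing S] (F : A →+* L)
    (g0 g1 : L →+* S) (hg : g0.comp F = g1.comp F)
    (hs : @Algebra.IsSeparable A L _ _ F.toAlgebra)
    (hn : ∀ x, (g1 x - g0 x) ^ 2 = 0) (x : L) : g1 x = g0 x := by
  letI := F.toAlgebra
  have hsep : (minpoly A x).Separable := hs.isSeparable' x
  have h0 : eval₂ F x (minpoly A x) = 0 := minpoly.aeval A x
  obtain ⟨a, b, hab⟩ := hsep
  set f := minpoly A x
  have e0 : (f.map (g0.comp F)).eval (g0 x) = 0 := by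
    rw [eval_map, ← hom_eval₂, h0, map_zero]
  have e1 : (f.map (g0.comp F)).eval (g1 x) = 0 := by
    rw [hg, eval_map, ← hom_eval₂, h0, map_zero]
  have hu : (b.map (g0.comp F)).eval (g0 x) *
      (derivative (f.map (g0.comp F))).eval (g0 x) = 1 := by
    have := congrArg (fun q => (q.map (g0.comp F)).eval (g0 x)) hab
    simp only [Polynomial.map_add, Polynomial.map_mul, eval_add, eval_mul, e0, mul_zero,
      zero_add, Polynomial.map_one, eval_one] at this
    rw [derivative_map]; exact this
  obtain ⟨k, hk⟩ := (f.map (g0.comp F)).binomExpansion (g0 x) (g1 x - g0 x)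
  rw [add_sub_cancel, e1, e0, hn, mul_zero, add_zero, zero_add] at hk
  have : g1 x - g0 x = 0 := by
    calc g1 x - g0 x = ((b.map (g0.comp F)).eval (g0 x) *
      (derivative (f.map (g0.comp F))).eval (g0 x)) * (g1 x - g0 x) := by rw [hu, one_mul]
      _ = 0 := by rw [mul_assoc, ← hk, mul_zero]
  exact sub_eq_zero.mp this

lemma cg_fst_snd {K R : Type*} [Field K] [CommRing R] [Algebra K R] (x v : Fin 2 → R)
    (q : MvPolynomial (Fin 2) K) :
    MvPolynomial.aeval (R := K) (fun i => (TrivSqZeroExt.inl (x i) + TrivSqZeroExt.inr (v i) :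
      TrivSqZeroExt R R)) q = TrivSqZeroExt.inl (MvPolynomial.aeval x q) +
      TrivSqZeroExt.inr (∑ i, v i * MvPolynomial.aeval x (MvPolynomial.pderiv i q)) := by
  induction q using MvPolynomial.induction_on with
  | C a => 
    simp [TrivSqZeroExt.algebraMap_eq_inl']
  | add p q hp hq =>
    simp only [map_add, hp, hq, mul_add, Finset.sum_add_distrib, TrivSqZeroExt.inl_add,
      TrivSqZeroExt.inr_add]
    ring
  | mul_X q j hq =>
    rw [map_mul, hq, MvPolynomial.aeval_X]
    ext
    · simp
    · fin_cases j <;> simp [MvPolynomial.pderiv_X, Pi.single_apply] <;> ring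

lemma cg_exists_hom (p : ℕ) [Fact p.Prime] {R : Type*} [CommRing R] [Algebra (RatFunc (ZMod p)) R]
    (x v : Fin 2 → R) (hx : MvPolynomial.aeval x (cgExamplePoly p) = 0) :
    ∃ φ : cgExampleB p →+* TrivSqZeroExt R R, ∀ q : MvPolynomial (Fin 2) (RatFunc (ZMod p)),
      φ (Ideal.Quotient.mk _ q) = TrivSqZeroExt.inl (MvPolynomial.aeval x q) +
      TrivSqZeroExt.inr (∑ i, v i * MvPolynomial.aeval x (MvPolynomial.pderiv i q)) := by
  have hp : (p : MvPolynomial (Fin 2) (RatFunc (ZMod p))) = 0 := by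
    haveI : CharP (RatFunc (ZMod p)) p := charP_of_injective_algebraMap
      (algebraMap (ZMod p) (RatFunc (ZMod p))).injective p
    have := CharP.cast_eq_zero (RatFunc (ZMod p)) p
    rw [← map_natCast (MvPolynomial.C (σ := Fin 2)), this, map_zero]
  refine ⟨Ideal.Quotient.lift _ (MvPolynomial.aeval (R := RatFunc (ZMod p))
    (fun i => (TrivSqZeroExt.inl (x i) + TrivSqZeroExt.inr (v i) :
      TrivSqZeroExt R R))).toRingHom ?_, ?_⟩
  · intro a ha
    obtain ⟨c, rfl⟩ := Ideal.mem_span_singleton.mp ha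
    rw [map_mul]
    have : ∀ i, MvPolynomial.pderiv i (cgExamplePoly p) = 0 := by
      intro i
      simp [cgExamplePoly, Derivation.leibniz_pow, hp, ← Nat.cast_smul_eq_nsmul
        (MvPolynomial (Fin 2) (RatFunc (ZMod p)))]
    have h2 := cg_fst_snd x v (cgExamplePoly p)
    simp only [hx, this, map_zero, mul_zero, Finset.sum_const_zero, TrivSqZeroExt.inl_zero,
      TrivSqZeroExt.inr_zero, add_zero] at h2
    exact mul_eq_zero_of_left h2 _
  · intro q
    rw [Ideal.Quotient.lift_mk]
    exact cg_fst_snd x v q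

instance cg_nontrivial (p : ℕ) [Fact p.Prime] : Nontrivial (cgExampleB p) := by
  apply Ideal.Quotient.nontrivial_iff.mpr
  intro h
  rw [Ideal.span_singleton_eq_top] at h
  have := h.map (MvPolynomial.aeval (R := RatFunc (ZMod p)) (fun _ : Fin 2 => (0 : RatFunc (ZMod p))))
  simp [cgExamplePoly, (Fact.out : p.Prime).ne_zero] at this

/-- For `B = 𝔽_p(t)[X,Y]/(tX^p + Y^p)` and any `z ∈ B` such that `𝔽_p(t)[z] ↪ B` is
module-finite, the extension `Frac(𝔽_p(t)[z]) → Frac(B)` is not separable. -/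
theorem not_separable_over_any_subring (p : ℕ) [Fact p.Prime] (z : cgExampleB p)
    (hfin : Module.Finite (Algebra.adjoin (RatFunc (ZMod p)) {z}) (cgExampleB p)) :
    ∀ F : FractionRing (Algebra.adjoin (RatFunc (ZMod p)) {z}) →+* FractionRing (cgExampleB p),
      F.comp (algebraMap (Algebra.adjoin (RatFunc (ZMod p)) {z})
          (FractionRing (Algebra.adjoin (RatFunc (ZMod p)) {z}))) =
        (algebraMap (cgExampleB p) (FractionRing (cgExampleB p))).comp
          (Algebra.adjoin (RatFunc (ZMod p)) {z}).val.toRingHom →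
      ¬ @Algebra.IsSeparable _ _ _ _ F.toAlgebra := by
  intro F hF hs
  obtain ⟨q, rfl⟩ := Ideal.Quotient.mk_surjective z
  set L := FractionRing (cgExampleB p) with hL
  set π : MvPolynomial (Fin 2) (RatFunc (ZMod p)) →ₐ[RatFunc (ZMod p)] cgExampleB p :=
    Ideal.Quotient.mkₐ _ _ with hπ
  set ι : cgExampleB p →+* L := algebraMap _ _ with hι
  have ιinj : Function.Injective ι := IsFractionRing.injective _ _
  let x : Fin 2 → L := fun i => ι (π (MvPolynomial.X i))
  have hx : ∀ r, MvPolynomial.aeval x r = ι (π r) := by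
    intro r
    have : MvPolynomial.aeval (R := RatFunc (ZMod p)) x =
        (IsScalarTower.toAlgHom (RatFunc (ZMod p)) (cgExampleB p) L).comp π := by
      ext i
      simp [x, hι]
    rw [this]; rfl
  -- the key: any tangent vector killing z is zero
  have key : ∀ v : Fin 2 → L,
      ∑ i, v i * MvPolynomial.aeval x (MvPolynomial.pderiv i q) = 0 → ∀ i, v i = 0 := by
    intro v hv
    obtain ⟨φ, hφ⟩ := cg_exists_hom p x v (by
      rw [hx]
      have : π (cgExamplePoly p) = 0 :=
        Ideal.Quotient.eq_zero_iff_mem.mpr (Ideal.mem_span_singleton_self _)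
      rw [this, map_zero])
    have hfst : ∀ b, (φ b).fst = ι b := by
      intro b
      obtain ⟨r, rfl⟩ := Ideal.Quotient.mk_surjective b
      rw [hφ, hx]
      exact add_zero _
    have hunit : ∀ y : nonZeroDivisors (cgExampleB p), IsUnit (φ y) := by
      intro y
      rw [TrivSqZeroExt.isUnit_iff_isUnit_fst, hfst]
      exact IsLocalization.map_units L y
    let g1 : L →+* TrivSqZeroExt L L := IsLocalization.lift hunit
    have hg1 : ∀ b, g1 (ι b) = φ b := fun b => IsLocalization.lift_eq hunit b
    let g0 : L →+* TrivSqZeroExt L L := TrivSqZeroExt.inlHom L L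
    have hfst1 : ∀ l, (g1 l).fst = l := by
      have : ((TrivSqZeroExt.fstHom L L L).toRingHom.comp g1) = RingHom.id L := by
        apply IsLocalization.ringHom_ext (nonZeroDivisors (cgExampleB p))
        refine RingHom.ext fun b => ?_
        exact (congrArg TrivSqZeroExt.fst (hg1 b)).trans (hfst b)
      intro l
      exact congrArg (fun h => h l) this
    have hg : g0.comp F = g1.comp F := by
      apply IsLocalization.ringHom_ext
        (nonZeroDivisors (Algebra.adjoin (RatFunc (ZMod p)) {(Ideal.Quotient.mk _ q : cgExampleB p)}))
      rw [RingHom.comp_assoc, RingHom.comp_assoc, hF]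
      ext1 ⟨a, ha⟩
      change g0 (ι a) = g1 (ι a)
      rw [hg1]
      induction ha using Algebra.adjoin_induction with
      | mem y hy =>
        rw [Set.mem_singleton_iff] at hy
        subst hy
        rw [hφ, hv, hx]
        simp [g0]
        rfl
      | algebraMap r =>
        have := hφ (MvPolynomial.C r)
        simp only [MvPolynomial.pderiv_C, map_zero, mul_zero, Finset.sum_const_zero,
          TrivSqZeroExt.inr_zero, add_zero, hx] at this
        exact this.symm
      | add a b _ _ h1 h2 => simp only [map_add, h1, h2]
      | mul a b _ _ h1 h2 => simp only [map_mul, h1, h2]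
    have hfin := cg_sep_unique F g0 g1 hg hs (by
      intro l
      have : g1 l - g0 l = TrivSqZeroExt.inr (g1 l).snd := by
        ext
        · simp [g0, hfst1]
        · simp [g0]
      rw [this, pow_two, TrivSqZeroExt.inr_mul_inr])
    intro i
    have h3 := congrArg TrivSqZeroExt.snd (hfin (x i))
    have h4 : g1 (x i) = _ := (hg1 _).trans (hφ (MvPolynomial.X i))
    rw [h4] at h3
    have h5 : (g0 (x i)).snd = 0 := rfl
    rw [h5] at h3
    simpa [MvPolynomial.pderiv_X, Pi.single_apply, apply_ite] using h3
  haveI : Nontrivial L := ιinj.nontrivial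
  have h1 := key ![MvPolynomial.aeval x (MvPolynomial.pderiv 1 q),
    -MvPolynomial.aeval x (MvPolynomial.pderiv 0 q)] (by simp [Fin.sum_univ_two]; ring)
  have a1 := h1 0
  have a0 := h1 1
  simp at a0 a1
  have h2 := key ![1, 0] (by simp [Fin.sum_univ_two, a0]) 0
  simp at h2
end
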